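/- arXiv:2208.09522 — 8 statements merged into one kernel-verified Lean document; each statement's English description precedes it below -/
import Mathlib

section
/- Let G = (V, E) be a finite directed graph and Φ a finite family of flows on G, where each flow φ has burst parameter b_φ ≥ 0, and suppose Φ obeys a locally dependent rate bound r with global burst parameter σ. Define β : E → ℝ≥0 by β(e) = Σ_{φ : ini_φ = e} (1 + b_φ), where ini_φ is the first edge of φ's path. Then the discretization A_Φ of Φ is a locally (r, σ, β)-bounded injection pattern. -/
/-- A route in the network `(V, E)` is a nonempty list of edges of `E` in which
consecutive edges share endpoints (a directed path, recorded by its edges). -/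
def IsRoute {V : Type*} (E : Finset (V × V)) (P : List (V × V)) : Prop :=
  P ≠ [] ∧ (∀ f ∈ P, f ∈ E) ∧ P.Chain' (fun f g => f.2 = g.1)

/-- `NST A S T e` : the number of packets of the injection pattern `A` injected at times
in `T`, with source buffer (first edge of the route) in `S`, whose route contains `e`. -/
def NST {V : Type*} [DecidableEq V] (A : ℕ → Multiset (List (V × V)))
    (S : Finset (V × V)) (T : Finset ℕ) (e : V × V) : ℕ :=
  ∑ t ∈ T, Multiset.countP (fun P => (∃ f ∈ S, P.head? = some f) ∧ e ∈ P) (A t)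

/-- `A` is locally `(ρ, σ, β)`-bounded. -/
def LocallyBounded {V : Type*} [DecidableEq V] (E : Finset (V × V))
    (A : ℕ → Multiset (List (V × V))) (ρ σ : ℝ) (β : V × V → ℝ) : Prop :=
  ∀ s t : ℕ, ∀ S ⊆ E, ∀ e ∈ E,
    (NST A S (Finset.Icc s t) e : ℝ)
      ≤ ρ * (Finset.Icc s t).card + σ + ∑ f ∈ S, β f

/-- The discretization of a family of flows `(a i, P i)` indexed by `i : ι`: at each
time `t ∈ ℕ`, it injects `⌊a i t⌋ − ⌊a i (t−1)⌋` packets with route `P i`. -/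
noncomputable def discretization {V : Type*} [DecidableEq V] {ι : Type*} [Fintype ι]
    (a : ι → ℝ → ℝ) (P : ι → List (V × V)) : ℕ → Multiset (List (V × V)) :=
  fun t => ∑ i : ι, Multiset.replicate (⌊a i t⌋ - ⌊a i ((t : ℝ) - 1)⌋).toNat (P i)

open Classical in
/-- Packets of a discretization counted by `NST`, flow by flow. -/
theorem NST_discretization {V : Type*} [DecidableEq V] {ι : Type*} [Fintype ι]
    (a : ι → ℝ → ℝ) (P : ι → List (V × V)) (S : Finset (V × V)) (T : Finset ℕ) (e : V × V) :
    NST (discretization a P) S T e =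
      ∑ i ∈ Finset.univ.filter (fun i => (∃ f ∈ S, (P i).head? = some f) ∧ e ∈ P i),
        ∑ t ∈ T, (⌊a i t⌋ - ⌊a i ((t : ℝ) - 1)⌋).toNat := by
  unfold NST discretization
  rw [Finset.sum_comm]
  refine Finset.sum_congr rfl fun t _ => ?_
  rw [← Multiset.coe_countPAddMonoidHom, map_sum, Finset.sum_filter]
  refine Finset.sum_congr rfl fun i _ => ?_
  simp only [Multiset.coe_countPAddMonoidHom, ← Multiset.coe_replicate, Multiset.coe_countP,
    List.countP_replicate, decide_eq_true_eq]

/-- The packets a single monotone flow injects during `[s, s + n]` telescope. -/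
theorem sum_toNat_floor_sub {f : ℝ → ℝ} (hf : Monotone f) (s n : ℕ) :
    ((∑ k ∈ Finset.Icc s (s + n), (⌊f k⌋ - ⌊f ((k : ℝ) - 1)⌋).toNat : ℕ) : ℤ) =
      ⌊f ((s + n : ℕ) : ℝ)⌋ - ⌊f ((s : ℝ) - 1)⌋ := by
  have h (k : ℕ) : ((⌊f k⌋ - ⌊f ((k : ℝ) - 1)⌋).toNat : ℤ) = ⌊f k⌋ - ⌊f ((k : ℝ) - 1)⌋ :=
    Int.toNat_of_nonneg (sub_nonneg.2 (Int.floor_mono (hf (by linarith))))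
  induction n with
  | zero => simpa using h s
  | succ n ih =>
    rw [← add_assoc, Finset.sum_Icc_succ_top (by omega), Nat.cast_add, ih, h]
    push_cast
    ring_nf

/-- the discretization of a finite family of flows obeying a locally
dependent rate bound `r` with global burst parameter `σ` and burst parameters `b i`
is a locally `(r, σ, β)`-bounded injection pattern, where
`β e = ∑_{i : ini (P i) = e} (1 + b i)`. -/
theorem stmt2 {V : Type*} [Fintype V] [DecidableEq V] [Inhabited V]
    (E : Finset (V × V)) {ι : Type*} [Fintype ι]
    (a : ι → ℝ → ℝ) (P : ι → List (V × V)) (b : ι → ℝ) (r σ : ℝ)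
    (hpath : ∀ i, IsRoute E (P i))
    (hzero : ∀ i, ∀ t : ℝ, t < 0 → a i t = 0)
    (hmono : ∀ i, Monotone (a i))
    (hb : ∀ i, 0 ≤ b i)
    (hburst : ∀ i, ∀ s t : ℝ, s < t → a i t - a i s ≤ r * (t - s) + b i)
    (hdep : ∀ e ∈ E, ∀ Ψ : Finset ι, (∀ i ∈ Ψ, e ∈ P i) → ∀ s t : ℝ, s < t →
      ∑ i ∈ Ψ, (a i t - a i s) ≤ r * (t - s) + σ + ∑ i ∈ Ψ, b i) :
    LocallyBounded E (discretization a P) r σ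
      (fun e => ∑ i ∈ Finset.univ.filter (fun i => (P i).headI = e), (1 + b i)) := by
  classical
  intro s t S _ e he
  rw [NST_discretization]
  set Ψ := Finset.univ.filter (fun i => (∃ f ∈ S, (P i).head? = some f) ∧ e ∈ P i) with hΨ
  have hΨβ : ∑ i ∈ Ψ, (1 + b i) ≤
      ∑ f ∈ S, ∑ i ∈ Finset.univ.filter (fun i => (P i).headI = f), (1 + b i) := by
    have hmaps : ∀ i ∈ Ψ, (P i).headI ∈ S := by
      intro i hi
      obtain ⟨⟨f, hf, hif⟩, -⟩ := (Finset.mem_filter.1 hi).2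
      cases hP : P i with
      | nil => simp [hP] at hif
      | cons g l =>
        obtain rfl : g = f := by simpa [hP] using hif
        exact hf
    rw [← Finset.sum_fiberwise_of_maps_to hmaps]
    refine Finset.sum_le_sum fun f _ => ?_
    refine Finset.sum_le_sum_of_subset_of_nonneg
      (Finset.filter_subset_filter _ (Finset.subset_univ _)) fun i _ _ => ?_
    linarith [hb i]
  rcases lt_or_ge t s with hts | hst
  · have hσ : 0 ≤ σ := by
      have hlim : Filter.Tendsto (fun x : ℝ => r * x + σ) (nhdsWithin 0 (Set.Ioi 0)) (nhds σ) := by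
        have hc : Continuous fun x : ℝ => r * x + σ := by fun_prop
        simpa using (hc.tendsto 0).mono_left nhdsWithin_le_nhds
      refine ge_of_tendsto hlim ?_
      filter_upwards [self_mem_nhdsWithin] with x hx
      simpa using hdep e he ∅ (by simp) 0 x hx
    have hΨ0 : 0 ≤ ∑ i ∈ Ψ, (1 + b i) := Finset.sum_nonneg fun i _ => by linarith [hb i]
    simp only [Finset.Icc_eq_empty (not_le.2 hts), Finset.sum_empty, Finset.sum_const_zero,
      Finset.card_empty, Nat.cast_zero, mul_zero]
    linarith
  · obtain ⟨n, rfl⟩ := Nat.exists_eq_add_of_le hst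
    have hflow (i : ι) :
        ((∑ k ∈ Finset.Icc s (s + n), (⌊a i k⌋ - ⌊a i ((k : ℝ) - 1)⌋).toNat : ℕ) : ℝ) ≤
          (a i ((s + n : ℕ) : ℝ) - a i ((s : ℝ) - 1)) + 1 := by
      have h := congrArg (Int.cast : ℤ → ℝ) (sum_toNat_floor_sub (hmono i) s n)
      rw [Int.cast_natCast, Int.cast_sub] at h
      rw [h]
      linarith [Int.floor_le (a i ((s + n : ℕ) : ℝ)), Int.lt_floor_add_one (a i ((s : ℝ) - 1))]
    have hrate := hdep e he Ψ (fun i hi => (Finset.mem_filter.1 hi).2.2)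
      ((s : ℝ) - 1) ((s + n : ℕ) : ℝ) (by push_cast; linarith [n.cast_nonneg (α := ℝ)])
    have hcard : ((Finset.Icc s (s + n)).card : ℝ) = ((s + n : ℕ) : ℝ) - ((s : ℝ) - 1) := by
      rw [Nat.card_Icc, Nat.cast_sub (by omega)]
      push_cast
      ring
    rw [Nat.cast_sum, hcard]
    have hsum := Finset.sum_le_sum fun i (_ : i ∈ Ψ) => hflow i
    rw [Finset.sum_add_distrib] at hsum hΨβ
    linarith
end

section
/- Let A be a locally (ρ, σ, β)-bounded injection pattern on a finite directed graph G such that no two distinct routes used by A share the same source buffer, and let C ≥ 1 be an integer. Then the C-reduction (1/C)A of A is locally (ρ/C, σ/C, β')-bounded, where β'(e) = 1 + β(e)/C for every edge e. -/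
/-- `cumCount A P t = a_P(t)`: the number of packets `(s, P) ∈ A` with `s ≤ t`,
counted with multiplicity. -/
def cumCount {V : Type*} [DecidableEq V] (A : ℕ → Multiset (List (V × V)))
    (P : List (V × V)) (t : ℕ) : ℕ :=
  ∑ s ∈ Finset.range (t + 1), (A s).count P

/-- The routes of packets of `A` injected at times `≤ t`. -/
def routesUpTo {V : Type*} [DecidableEq V] (A : ℕ → Multiset (List (V × V)))
    (t : ℕ) : Finset (List (V × V)) :=
  (∑ s ∈ Finset.range (t + 1), A s).toFinset

/-- The number of packets with route `P` injected at time `t` by the `C`-reduction of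
`A`, namely `⌊a_P(t)/C⌋ − ⌊a_P(t−1)/C⌋`. -/
def redCount {V : Type*} [DecidableEq V] (A : ℕ → Multiset (List (V × V)))
    (C : ℕ) (P : List (V × V)) : ℕ → ℕ
  | 0 => cumCount A P 0 / C
  | t + 1 => cumCount A P (t + 1) / C - cumCount A P t / C

/-- The `C`-reduction `(1/C)A` of the injection pattern `A`. -/
def cReduction {V : Type*} [DecidableEq V] (A : ℕ → Multiset (List (V × V)))
    (C : ℕ) : ℕ → Multiset (List (V × V)) :=
  fun t => ∑ P ∈ routesUpTo A t, Multiset.replicate (redCount A C P t) P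

theorem Multiset.countP_eq_sum_count_filter {α : Type*} [DecidableEq α] (p : α → Prop)
    [DecidablePred p] (m : Multiset α) (F : Finset α) (h : ∀ a ∈ m, a ∈ F) :
    m.countP p = ∑ a ∈ F.filter p, m.count a := by
  rw [Multiset.countP_eq_card_filter, ← Multiset.sum_count_eq_card (s := F.filter p)]
  · refine Finset.sum_congr rfl fun a ha => ?_
    exact Multiset.count_filter_of_pos (Finset.mem_filter.1 ha).2
  · intro a ha
    rw [Multiset.mem_filter] at ha
    exact Finset.mem_filter.2 ⟨h a ha.1, ha.2⟩

section Reduction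

variable {V : Type*} [DecidableEq V] (A : ℕ → Multiset (List (V × V)))

theorem mem_routesUpTo {t : ℕ} {P : List (V × V)} :
    P ∈ routesUpTo A t ↔ ∃ s ≤ t, P ∈ A s := by
  simp [routesUpTo, Multiset.mem_sum]

theorem NST_eq_sum_routes (B : ℕ → Multiset (List (V × V))) (S : Finset (V × V))
    (T : Finset ℕ) (e : V × V) (F : Finset (List (V × V)))
    (h : ∀ u ∈ T, ∀ P ∈ B u, P ∈ F) :
    NST B S T e = ∑ P ∈ F.filter (fun P => (∃ f ∈ S, P.head? = some f) ∧ e ∈ P),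
      ∑ u ∈ T, (B u).count P := by
  rw [Finset.sum_comm, NST]
  exact Finset.sum_congr rfl fun u hu =>
    Multiset.countP_eq_sum_count_filter _ _ F (h u hu)

theorem redCount_eq_zero_of_notMem (C : ℕ) {P : List (V × V)} {t : ℕ}
    (h : P ∉ routesUpTo A t) : redCount A C P t = 0 := by
  have h0 : cumCount A P t = 0 := by
    refine Finset.sum_eq_zero fun s hs => Multiset.count_eq_zero.2 fun hP => h ?_
    exact (mem_routesUpTo A).2 ⟨s, Nat.lt_succ_iff.1 (Finset.mem_range.1 hs), hP⟩
  cases t <;> simp [redCount, h0]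

theorem count_cReduction (C : ℕ) (P : List (V × V)) (t : ℕ) :
    (cReduction A C t).count P = redCount A C P t := by
  rw [cReduction, Multiset.count_sum']
  simp only [Multiset.count_replicate]
  rw [Finset.sum_ite_eq']
  split_ifs with h
  · rfl
  · exact (redCount_eq_zero_of_notMem A C h).symm

theorem mem_routesUpTo_of_mem_cReduction {C t : ℕ} {P : List (V × V)}
    (h : P ∈ cReduction A C t) : P ∈ routesUpTo A t := by
  by_contra hP
  rw [← Multiset.count_pos, count_cReduction, redCount_eq_zero_of_notMem A C hP] at h
  exact lt_irrefl _ h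

theorem sum_range_redCount (C : ℕ) (P : List (V × V)) (n : ℕ) :
    ∑ u ∈ Finset.range n, redCount A C P u
      = (∑ u ∈ Finset.range n, (A u).count P) / C := by
  induction n with
  | zero => simp
  | succ n ih =>
    rw [Finset.sum_range_succ, ih]
    cases n with
    | zero => simp [redCount, cumCount]
    | succ n =>
      exact Nat.add_sub_of_le
        (Nat.div_le_div_right (Finset.sum_le_sum_of_subset (Finset.range_mono (Nat.le_succ _))))

theorem mul_sum_redCount_le {C : ℕ} (hC : 1 ≤ C) (P : List (V × V)) (s t : ℕ) :
    C * ∑ u ∈ Finset.Icc s t, redCount A C P u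
      ≤ ∑ u ∈ Finset.Icc s t, (A u).count P + C := by
  rcases lt_or_ge t s with h | h
  · simp [Finset.Icc_eq_empty_of_lt h]
  have hs : s ≤ t + 1 := by omega
  have hI : Finset.Icc s t = Finset.Ico s (t + 1) := by ext; simp
  have h1 := Finset.sum_range_add_sum_Ico (fun u => redCount A C P u) hs
  have h2 := Finset.sum_range_add_sum_Ico (fun u => (A u).count P) hs
  rw [sum_range_redCount, sum_range_redCount] at h1
  rw [hI]
  have h3 := Nat.mul_div_le (∑ u ∈ Finset.range (t + 1), (A u).count P) C
  have h4 := Nat.lt_mul_div_succ (∑ u ∈ Finset.range s, (A u).count P) hC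
  rw [← h1] at h3
  rw [mul_add] at h3 h4
  omega

end Reduction

/-- if `A` is locally `(ρ, σ, β)`-bounded and no two distinct routes used
by `A` share the same source buffer, then the `C`-reduction of `A` is locally
`(ρ/C, σ/C, e ↦ 1 + β(e)/C)`-bounded. -/
theorem stmt3 {V : Type*} [Fintype V] [DecidableEq V] (E : Finset (V × V))
    (A : ℕ → Multiset (List (V × V))) (ρ σ : ℝ) (β : V × V → ℝ) (C : ℕ)
    (hC : 1 ≤ C) (hρ : 0 < ρ) (hσ : 0 ≤ σ) (hβ : ∀ e, 0 ≤ β e)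
    (hvalid : ∀ t, ∀ P ∈ A t, IsRoute E P)
    (hsrc : ∀ s t : ℕ, ∀ P Q : List (V × V),
      P ∈ A s → Q ∈ A t → P.head? = Q.head? → P = Q)
    (hA : LocallyBounded E A ρ σ β) :
    LocallyBounded E (cReduction A C) (ρ / C) (σ / C) (fun e => 1 + β e / C) := by
  intro s t S hS e he
  have hC0 : (0 : ℝ) < C := by exact_mod_cast hC
  have hmono : ∀ u ∈ Finset.Icc s t, ∀ P, P ∈ routesUpTo A u → P ∈ routesUpTo A t := by
    intro u hu P hP
    obtain ⟨v, hv, hPv⟩ := (mem_routesUpTo A).1 hP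
    exact (mem_routesUpTo A).2 ⟨v, hv.trans (Finset.mem_Icc.1 hu).2, hPv⟩
  have hred := NST_eq_sum_routes (cReduction A C) S (Finset.Icc s t) e (routesUpTo A t)
    fun u hu P hP => hmono u hu P (mem_routesUpTo_of_mem_cReduction A hP)
  have horig := NST_eq_sum_routes A S (Finset.Icc s t) e (routesUpTo A t)
    fun u hu P hP => hmono u hu P ((mem_routesUpTo A).2 ⟨u, le_rfl, hP⟩)
  simp only [count_cReduction] at hred
  set R := (routesUpTo A t).filter (fun P => (∃ f ∈ S, P.head? = some f) ∧ e ∈ P)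
  have hcard : R.card ≤ S.card := by
    rw [← Finset.card_image_of_injective S (Option.some_injective _)]
    refine Finset.card_le_card_of_injOn List.head? ?_ ?_
    · intro P hP
      obtain ⟨f, hf, hPf⟩ := (Finset.mem_filter.1 hP).2.1
      exact Finset.mem_coe.2 (Finset.mem_image.2 ⟨f, hf, hPf.symm⟩)
    · intro P hP Q hQ hPQ
      obtain ⟨u, -, hPu⟩ := (mem_routesUpTo A).1 (Finset.mem_filter.1 hP).1
      obtain ⟨v, -, hQv⟩ := (mem_routesUpTo A).1 (Finset.mem_filter.1 hQ).1
      exact hsrc u v P Q hPu hQv hPQ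
  have hnat : C * NST (cReduction A C) S (Finset.Icc s t) e
      ≤ NST A S (Finset.Icc s t) e + S.card * C := by
    calc C * NST (cReduction A C) S (Finset.Icc s t) e
        ≤ ∑ P ∈ R, (∑ u ∈ Finset.Icc s t, (A u).count P + C) := by
          rw [hred, Finset.mul_sum]
          exact Finset.sum_le_sum fun P _ => mul_sum_redCount_le A hC P s t
      _ = NST A S (Finset.Icc s t) e + R.card * C := by
          rw [Finset.sum_add_distrib, ← horig, Finset.sum_const, smul_eq_mul]
      _ ≤ _ := by gcongr
  have hreal : (C : ℝ) * NST (cReduction A C) S (Finset.Icc s t) e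
      ≤ NST A S (Finset.Icc s t) e + S.card * C := by exact_mod_cast hnat
  have hbound := hA s t S hS e he
  rw [Finset.sum_add_distrib, ← Finset.sum_div, Finset.sum_const, nsmul_eq_mul, mul_one]
  refine le_of_mul_le_mul_left (hreal.trans ?_) hC0
  calc (NST A S (Finset.Icc s t) e : ℝ) + S.card * C
      ≤ ρ * (Finset.Icc s t).card + σ + ∑ f ∈ S, β f + S.card * C := by gcongr
    _ = _ := by field_simp; ring
end

section
/- Let F be a deterministic online forwarding protocol on the unit-capacity single-destination path of size n, and let f : ℝ≥0 × ℝ≥0 → ℝ be such that for all σ' ≥ 0 and B' ≥ 0, every locally (1, σ', B')-bounded injection pattern produces loads satisfying sup_{t,i} L(t, i) ≤ f(σ', B') under F. Let C ≥ 1 be an integer and let A be a locally (C, σ, B)-bounded injection pattern given by counts a(t, i), with cumulative counts cum(t, i) = Σ_{s ≤ t} a(s, i). Run F on the C-reduction a'(t, i) = ⌊cum(t, i)/C⌋ − ⌊cum(t − 1, i)/C⌋ (each forwarded unit corresponding to a bundle of C original packets, with un-bundled packets held in reserve), yielding loads L'. Then for all rounds t and buffers i, the total number of original packets residing at buffer i,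 namely C·L'(t, i) + (cum(t, i) − C·⌊cum(t, i)/C⌋), is at most C·f(σ/C, 1 + B/C) + C. -/
/-- Injection patterns on the single-destination path of size `n` inject only into
buffers `1, …, n`. -/
def pathSupp (n : ℕ) (a : ℕ → ℕ → ℕ) : Prop :=
  ∀ t i, i ∉ Finset.Icc 1 n → a t i = 0

/-- The injection pattern `a` on the single-destination path of size `n` is locally
`(ρ, σ, β)`-bounded. -/
def LBPath (n : ℕ) (a : ℕ → ℕ → ℕ) (ρ σ : ℝ) (β : ℕ → ℝ) : Prop :=
  ∀ s t : ℕ, ∀ S ⊆ Finset.Icc 1 n, ∀ e ∈ Finset.Icc 1 n,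
    ((∑ r ∈ Finset.Icc s t, ∑ i ∈ S.filter (fun i => i ≤ e), a r i : ℕ) : ℝ)
      ≤ ρ * (Finset.Icc s t).card + σ + ∑ i ∈ S, β i

/-- The injection pattern `a` on the single-destination path of size `n` is
`(ρ, σ)`-bounded. -/
def BPath (n : ℕ) (a : ℕ → ℕ → ℕ) (ρ σ : ℝ) : Prop :=
  ∀ s t : ℕ, ∀ e ∈ Finset.Icc 1 n,
    ((∑ r ∈ Finset.Icc s t, ∑ i ∈ (Finset.Icc 1 n).filter (fun i => i ≤ e), a r i : ℕ) : ℝ)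
      ≤ ρ * (Finset.Icc s t).card + σ

/-- The Odd-Even Downhill forwarding decision for buffer `i` given the load
configuration `L` (with the convention `L (n+1) = 0`): buffer `i ∈ {1, …, n}` forwards
iff `L i > L (i+1)`, or `L i = L (i+1)` and `L i` is odd. -/
def oedF (n : ℕ) (L : ℕ → ℕ) (i : ℕ) : ℕ :=
  if 1 ≤ i ∧ i ≤ n ∧
      ((if i + 1 ≤ n then L (i + 1) else 0) < L i ∨
        (L i = (if i + 1 ≤ n then L (i + 1) else 0) ∧ Odd (L i)))
  then 1 else 0

/-- The loads of the OED protocol running on the injection pattern `a`: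
`oedL n a t i` is the load of buffer `i` at round `t` after injections, with
`L(0, i) = 0` and `L(t+1, i) = L(t, i) − F(t, i) + F(t, i−1) + a(t+1, i)`. -/
def oedL (n : ℕ) (a : ℕ → ℕ → ℕ) : ℕ → ℕ → ℕ
  | 0 => fun _ => 0
  | t + 1 => fun i =>
      oedL n a t i - oedF n (oedL n a t) i + oedF n (oedL n a t) (i - 1) + a (t + 1) i
/-- The loads produced by a forwarding protocol `Fp` (where `Fp t a i ∈ {0,1}` is the
decision of buffer `i` at round `t` on the injection pattern `a`): `L(0, i) = 0` and
`L(t+1, i) = L(t, i) − F(t, i) + F(t, i−1) + a(t+1, i)`. -/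
def protL (n : ℕ) (Fp : ℕ → (ℕ → ℕ → ℕ) → ℕ → ℕ) (a : ℕ → ℕ → ℕ) : ℕ → ℕ → ℕ
  | 0 => fun _ => 0
  | t + 1 => fun i =>
      protL n Fp a t i - Fp t a i + Fp t a (i - 1) + a (t + 1) i

/-- `Fp` is a deterministic online forwarding protocol on the unit-capacity
single-destination path of size `n`: its decisions at round `t` depend only on the
history of injections through round `t`, are in `{0, 1}`, are `0` on empty buffers,
and are `0` outside the buffers `1, …, n`. -/
def ValidProt (n : ℕ) (Fp : ℕ → (ℕ → ℕ → ℕ) → ℕ → ℕ) : Prop :=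
  (∀ t : ℕ, ∀ a a' : ℕ → ℕ → ℕ, (∀ s ≤ t, a s = a' s) → Fp t a = Fp t a') ∧
  (∀ t : ℕ, ∀ a : ℕ → ℕ → ℕ, ∀ i, Fp t a i ≤ 1) ∧
  (∀ a : ℕ → ℕ → ℕ, ∀ t i, protL n Fp a t i = 0 → Fp t a i = 0) ∧
  (∀ t : ℕ, ∀ a : ℕ → ℕ → ℕ, ∀ i, ¬(1 ≤ i ∧ i ≤ n) → Fp t a i = 0)
/-- `cum a t i` : the cumulative number of packets injected into buffer `i` through
round `t`. -/
def cum (a : ℕ → ℕ → ℕ) (t i : ℕ) : ℕ := ∑ s ∈ Finset.range (t + 1), a s i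

/-- The `C`-reduction of the injection pattern `a`: at round `t` it injects
`⌊cum(t, i)/C⌋ − ⌊cum(t−1, i)/C⌋` jumbo packets into buffer `i`. -/
def cRed (C : ℕ) (a : ℕ → ℕ → ℕ) : ℕ → ℕ → ℕ
  | 0 => fun i => cum a 0 i / C
  | t + 1 => fun i => cum a (t + 1) i / C - cum a t i / C

theorem cum_succ (a : ℕ → ℕ → ℕ) (t i : ℕ) :
    cum a (t + 1) i = cum a t i + a (t + 1) i :=
  Finset.sum_range_succ _ _

theorem mul_cRed_succ_add_mod (C : ℕ) (a : ℕ → ℕ → ℕ) (t i : ℕ) :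
    C * cRed C a (t + 1) i + cum a (t + 1) i % C = a (t + 1) i + cum a t i % C := by
  have hle : C * (cum a t i / C) ≤ C * (cum a (t + 1) i / C) :=
    Nat.mul_le_mul_left _ (Nat.div_le_div_right (by rw [cum_succ]; omega))
  have h₁ := Nat.div_add_mod (cum a (t + 1) i) C
  have h₂ := Nat.div_add_mod (cum a t i) C
  have h₃ := cum_succ a t i
  simp only [cRed, Nat.mul_sub]
  omega

/-- Over any interval of rounds, the bundles formed at a buffer together with the final
reserve contain at most `C` packets more than were injected during the interval. -/
theorem mul_sum_cRed_add_mod_le {C : ℕ} (hC : 1 ≤ C) (a : ℕ → ℕ → ℕ) (s t i : ℕ) :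
    C * ∑ r ∈ Finset.Icc s t, cRed C a r i + cum a t i % C
      ≤ ∑ r ∈ Finset.Icc s t, a r i + C := by
  induction t with
  | zero =>
    have hlt := Nat.mod_lt (cum a 0 i) hC
    rcases Nat.eq_zero_or_pos s with rfl | hs
    · have h := Nat.div_add_mod (cum a 0 i) C
      have h₀ : cum a 0 i = a 0 i := by simp [cum]
      simp only [Finset.Icc_self, Finset.sum_singleton, cRed]
      omega
    · simp only [Finset.Icc_eq_empty_of_lt hs, Finset.sum_empty]
      omega
  | succ t ih =>
    rcases Nat.lt_or_ge (t + 1) s with hs | hs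
    · have hlt := Nat.mod_lt (cum a (t + 1) i) hC
      simp only [Finset.Icc_eq_empty_of_lt hs, Finset.sum_empty]
      omega
    · have h := mul_cRed_succ_add_mod C a t i
      rw [Finset.sum_Icc_succ_top hs, Finset.sum_Icc_succ_top hs, Nat.mul_add]
      omega

theorem pathSupp.cRed {n : ℕ} {a : ℕ → ℕ → ℕ} (ha : pathSupp n a) (C : ℕ) :
    pathSupp n (cRed C a) := by
  intro t i hi
  have h : ∀ t, cum a t i = 0 := fun t => Finset.sum_eq_zero fun s _ => ha s i hi
  cases t <;> simp [_root_.cRed, h]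

/-- The `C`-reduction of a locally `(C, σ, B)`-bounded pattern is locally
`(1, σ / C, 1 + B / C)`-bounded. -/
theorem LBPath.cRed {n C : ℕ} {a : ℕ → ℕ → ℕ} {σ B : ℝ} (hC : 1 ≤ C)
    (hA : LBPath n a C σ (fun _ => B)) :
    LBPath n (cRed C a) 1 (σ / C) (fun _ => 1 + B / C) := by
  intro s t S hS e he
  have hCpos : (0 : ℝ) < C := by exact_mod_cast hC
  have key : C * ∑ r ∈ Finset.Icc s t, ∑ i ∈ S.filter (fun i => i ≤ e), _root_.cRed C a r i
      ≤ ∑ r ∈ Finset.Icc s t, ∑ i ∈ S.filter (fun i => i ≤ e), a r i + S.card * C := by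
    rw [Finset.sum_comm, Finset.sum_comm (s := Finset.Icc s t), Finset.mul_sum]
    calc _ ≤ ∑ i ∈ S.filter (fun i => i ≤ e), (∑ r ∈ Finset.Icc s t, a r i + C) :=
          Finset.sum_le_sum fun i _ =>
            (Nat.le_add_right _ _).trans (mul_sum_cRed_add_mod_le hC a s t i)
      _ ≤ _ := by
          rw [Finset.sum_add_distrib, Finset.sum_const, smul_eq_mul]
          gcongr
          exact Finset.filter_subset _ _
  have hbound := hA s t S hS e he
  have key' := (Nat.cast_le (α := ℝ)).mpr key
  rw [Nat.cast_mul, Nat.cast_add, Nat.cast_mul] at key'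
  rw [Finset.sum_const, nsmul_eq_mul] at hbound ⊢
  refine le_of_mul_le_mul_left ?_ hCpos
  have hexp : (C : ℝ) * (1 * (Finset.Icc s t).card + σ / C + S.card * (1 + B / C))
      = C * (Finset.Icc s t).card + σ + S.card * B + S.card * C := by
    field_simp
    ring
  rw [hexp]
  linarith

/-- if the deterministic online protocol `Fp` guarantees buffer loads at
most `f σ' B'` on every locally `(1, σ', B')`-bounded pattern on the unit-capacity
single-destination path of size `n`, then running `Fp` on the `C`-reduction of any
locally `(C, σ, B)`-bounded pattern `a` keeps the total number of original packets at
each buffer — `C` per jumbo packet plus the un-bundled reserve — at most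
`C·f(σ/C, 1 + B/C) + C`. -/
theorem stmt4 (n : ℕ) (Fp : ℕ → (ℕ → ℕ → ℕ) → ℕ → ℕ) (hFp : ValidProt n Fp)
    (f : ℝ → ℝ → ℝ)
    (hf : ∀ σ' B' : ℝ, 0 ≤ σ' → 0 ≤ B' →
      ∀ a' : ℕ → ℕ → ℕ, pathSupp n a' → LBPath n a' 1 σ' (fun _ => B') →
      ∀ t : ℕ, ∀ i ∈ Finset.Icc 1 n, (protL n Fp a' t i : ℝ) ≤ f σ' B')
    (C : ℕ) (hC : 1 ≤ C) (σ B : ℝ) (hσ : 0 ≤ σ) (hB : 0 ≤ B)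
    (a : ℕ → ℕ → ℕ) (ha : pathSupp n a) (hA : LBPath n a C σ (fun _ => B)) :
    ∀ t : ℕ, ∀ i ∈ Finset.Icc 1 n,
      ((C * protL n Fp (cRed C a) t i + (cum a t i - C * (cum a t i / C)) : ℕ) : ℝ)
        ≤ C * f (σ / C) (1 + B / C) + C := by
  intro t i hi
  have hL := hf (σ / C) (1 + B / C) (by positivity) (by positivity) _ (ha.cRed C)
    (hA.cRed hC) t i hi
  have hreserve : cum a t i - C * (cum a t i / C) ≤ C := by
    have h := Nat.div_add_mod (cum a t i) C
    have hlt := Nat.mod_lt (cum a t i) hC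
    omega
  rw [Nat.cast_add, Nat.cast_mul]
  gcongr
end

section
/- There exists a constant c > 0 (independent of n, ρ, σ, B, and the adversary) such that the following holds: for every n ≥ 1, every ρ ≤ 1, every σ, B ≥ 0, and every locally (ρ, σ, B)-bounded injection pattern on the single-destination path of size n, the loads produced by the Odd-Even Downhill (OED) protocol satisfy sup_{t,i} L(t, i) ≤ c·((B + 1)·log₂(n + 1) + σ + 1). -/
/-- The number of packets stored in buffers `1, …, i` under the configuration `L`. -/
def cumLoad (L : ℕ → ℕ) (i : ℕ) : ℤ := ∑ j ∈ Finset.range i, (L (j + 1) : ℤ)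

/-- The number of packets injected into the buffers of `S` during the rounds `s + 1, …, t`. -/
def injCount (a : ℕ → ℕ → ℕ) (s t : ℕ) (S : Finset ℕ) : ℕ :=
  ∑ r ∈ Finset.Ioc s t, ∑ i ∈ S, a r i

lemma cumLoad_succ (L : ℕ → ℕ) (i : ℕ) : cumLoad L (i + 1) = cumLoad L i + L (i + 1) := by
  simp [cumLoad, Finset.sum_range_succ]

lemma oedF_le_one (n : ℕ) (L : ℕ → ℕ) (i : ℕ) : oedF n L i ≤ 1 := by
  unfold oedF; split_ifs <;> omega

lemma oedF_zero (n : ℕ) (L : ℕ → ℕ) : oedF n L 0 = 0 := by simp [oedF]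

lemma oedF_le_load (n : ℕ) (L : ℕ → ℕ) (i : ℕ) : oedF n L i ≤ L i := by
  rcases Nat.eq_zero_or_pos (L i) with h | h
  · rw [oedF, if_neg]
    · exact Nat.zero_le _
    · rintro ⟨-, -, h1 | ⟨-, h1⟩⟩
      · omega
      · rw [h] at h1
        exact absurd h1 (by decide)
  · exact (oedF_le_one n L i).trans h

lemma cumLoad_oedL_succ (n : ℕ) (a : ℕ → ℕ → ℕ) (t i : ℕ) :
    cumLoad (oedL n a (t + 1)) i
      = cumLoad (oedL n a t) i - oedF n (oedL n a t) i + cumLoad (a (t + 1)) i := by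
  induction i with
  | zero => simp [cumLoad, oedF_zero]
  | succ i ih =>
    have h := oedF_le_load n (oedL n a t) (i + 1)
    rw [cumLoad_succ, cumLoad_succ, cumLoad_succ, ih]
    have : oedL n a (t + 1) (i + 1) = oedL n a t (i + 1) - oedF n (oedL n a t) (i + 1)
        + oedF n (oedL n a t) i + a (t + 1) (i + 1) := rfl
    rw [this]
    push_cast [Nat.cast_sub h]
    ring

lemma cumLoad_sub_le (b : ℕ → ℕ) {p q : ℕ} (hpq : p ≤ q) {S : Finset ℕ}
    (hS : Finset.Ioc p q ⊆ S) : cumLoad b q - cumLoad b p ≤ ((∑ i ∈ S, b i : ℕ) : ℤ) := by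
  have key : cumLoad b q - cumLoad b p = ((∑ i ∈ Finset.Ioc p q, b i : ℕ) : ℤ) := by
    induction q, hpq using Nat.le_induction with
    | base => simp
    | succ q hq ih =>
      rw [cumLoad_succ, ← Finset.insert_Ioc_right_eq_Ioc_add_one hq, Finset.sum_insert (by simp)]
      have := ih ((Finset.Ioc_subset_Ioc_right (Nat.le_succ q)).trans hS)
      push_cast at this ⊢
      linarith
  rw [key]
  exact_mod_cast Finset.sum_le_sum_of_subset hS

/-- Before injections, the tilted cumulative load `Q i - u * i` with `u` odd drops by one below
its maximum over the neighbourhood of `i` in the previous round. -/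
lemma exists_neighbor_upper (n : ℕ) (L : ℕ → ℕ) {i : ℕ} (hi : 1 ≤ i) (hin : i ≤ n) {u : ℤ}
    (hu : Odd u) (hu1 : 1 ≤ u) :
    ∃ i' ≤ n, i' ≤ i + 1 ∧ i ≤ i' + 1 ∧
      cumLoad L i - oedF n L i - u * i ≤ cumLoad L i' - u * i' - 1 ∧
      (i' + 1 = i → (L i : ℤ) + 1 ≤ u) := by
  obtain ⟨m, rfl⟩ : ∃ m, i = m + 1 := ⟨i - 1, by omega⟩
  by_cases hF : oedF n L (m + 1) = 1
  · exact ⟨m + 1, hin, by omega, by omega, by rw [hF]; push_cast; linarith, by omega⟩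
  have hF0 : oedF n L (m + 1) = 0 := by
    have := oedF_le_one n L (m + 1); omega
  rw [hF0]
  by_cases hR : m + 1 + 1 ≤ n ∧ u + 1 ≤ L (m + 1 + 1)
  · refine ⟨m + 1 + 1, hR.1, by omega, by omega, ?_, by omega⟩
    rw [cumLoad_succ L (m + 1)]
    push_cast
    linarith [hR.2]
  have hL : (L (m + 1) : ℤ) + 1 ≤ u := by
    have hu' := hu
    by_contra hcon
    apply hF
    unfold oedF
    rw [if_pos]
    refine ⟨hi, hin, ?_⟩
    split_ifs with hn
    · by_cases hlt : L (m + 1 + 1) < L (m + 1)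
      · exact Or.inl hlt
      · right
        have h2 : ¬ (u + 1 ≤ L (m + 1 + 1)) := fun h => hR ⟨hn, h⟩
        have h3 : (L (m + 1) : ℤ) = u := by omega
        refine ⟨by omega, ?_⟩
        rw [← h3] at hu'
        exact_mod_cast hu'
    · left; omega
  refine ⟨m, by omega, by omega, by omega, ?_, fun _ => hL⟩
  rw [cumLoad_succ L m]
  push_cast
  linarith

/-- Before injections, the tilted cumulative load `Q p - v * p` with `v` even stays above its
minimum over the neighbourhood of `p` in the previous round. -/
lemma exists_neighbor_lower (n : ℕ) (L : ℕ → ℕ) {p : ℕ} (hp : p < n) {v : ℤ} (hv : Even v) :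
    ∃ p', p' ≤ p + 1 ∧ p ≤ p' + 1 ∧
      cumLoad L p' - v * p' ≤ cumLoad L p - oedF n L p - v * p ∧
      (p' = p + 1 → (L (p + 1) : ℤ) + 1 ≤ v) := by
  by_cases hF : oedF n L p = 0
  · exact ⟨p, by omega, by omega, by rw [hF]; simp, by omega⟩
  have hF1 : oedF n L p = 1 := by
    have := oedF_le_one n L p; omega
  have hcond : 1 ≤ p ∧ p ≤ n ∧ ((if p + 1 ≤ n then L (p + 1) else 0) < L p ∨
      (L p = (if p + 1 ≤ n then L (p + 1) else 0) ∧ Odd (L p))) := by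
    by_contra h
    exact hF (by unfold oedF; rw [if_neg h])
  rw [if_pos (by omega)] at hcond
  obtain ⟨h1, -, hc⟩ := hcond
  obtain ⟨m, rfl⟩ : ∃ m, p = m + 1 := ⟨p - 1, by omega⟩
  rw [hF1]
  by_cases hl : v + 1 ≤ L (m + 1)
  · refine ⟨m, by omega, by omega, ?_, by omega⟩
    rw [cumLoad_succ L m]
    push_cast
    linarith
  have hL : (L (m + 1 + 1) : ℤ) + 1 ≤ v := by
    rcases hc with h | ⟨h, ho⟩
    · omega
    · have hne : (L (m + 1) : ℤ) ≠ v := by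
        rintro rfl
        exact (Nat.not_even_iff_odd.mpr ho) (by exact_mod_cast hv)
      omega
  refine ⟨m + 1 + 1, by omega, by omega, ?_, fun _ => hL⟩
  rw [cumLoad_succ L (m + 1)]
  push_cast
  linarith

lemma injCount_add_round (a : ℕ → ℕ → ℕ) {r t : ℕ} (h : r < t) (S : Finset ℕ) :
    injCount a r t S = injCount a (r + 1) t S + ∑ i ∈ S, a (r + 1) i := by
  unfold injCount
  have : Finset.Ioc r t = insert (r + 1) (Finset.Ioc (r + 1) t) := by
    ext x; simp; omega
  rw [this, Finset.sum_insert (by simp), add_comm]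

lemma injCount_concat (a : ℕ → ℕ → ℕ) {s₀ s t : ℕ} (h₀ : s₀ ≤ s) (h : s ≤ t)
    (S₀ S : Finset ℕ) :
    injCount a s₀ s S₀ + injCount a s t S ≤ injCount a s₀ t (S₀ ∪ S) := by
  unfold injCount
  rw [← Finset.Ioc_union_Ioc_eq_Ioc h₀ h, Finset.sum_union (Finset.Ioc_disjoint_Ioc_of_le le_rfl)]
  exact add_le_add
    (Finset.sum_le_sum fun r _ => Finset.sum_le_sum_of_subset Finset.subset_union_left)
    (Finset.sum_le_sum fun r _ => Finset.sum_le_sum_of_subset Finset.subset_union_right)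

/-- The load of the interval `(p, q]` at round `t` is controlled by that of `(p', q']` at the
earlier round `s`, the right and left end points being tracked back with the tilts `u`
and `v`. -/
def PairBound (n : ℕ) (a : ℕ → ℕ → ℕ) (t p q : ℕ) (S : Finset ℕ) (u v : ℤ)
    (s p' q' : ℕ) : Prop :=
  cumLoad (oedL n a t) q - cumLoad (oedL n a t) p
    ≤ cumLoad (oedL n a s) q' - cumLoad (oedL n a s) p' + u * ((q : ℤ) - q')
      - v * ((p : ℤ) - p') + injCount a s t S - ((t : ℤ) - s)

/-- The bound on the load of `(p, q]` at round `t` obtained when the tracked end points meet at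
round `s`. -/
def MeetBound (n : ℕ) (a : ℕ → ℕ → ℕ) (t p q : ℕ) (S : Finset ℕ) (v D : ℤ) (s : ℕ) : Prop :=
  cumLoad (oedL n a t) q - cumLoad (oedL n a t) p
    ≤ v * ((q : ℤ) - p) + D + 1 + injCount a s t S - ((t : ℤ) - s)

lemma PairBound.step {n : ℕ} {a : ℕ → ℕ → ℕ} {t p q : ℕ} {S : Finset ℕ} {u v D : ℤ}
    {r p' q' q'' : ℕ} (hr : r < t) (hv : Even v) (hpq : p' < q') (hqn : q' ≤ n)
    (hS : Finset.Ioc p' q' ⊆ S)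
    (hD : (u - v) * ((q : ℤ) - q') ≤ D) (hD' : (u - v) * ((q : ℤ) - q'') ≤ D)
    (hq1 : q' ≤ q'' + 1)
    (hup : cumLoad (oedL n a r) q' - oedF n (oedL n a r) q' - u * q'
      ≤ cumLoad (oedL n a r) q'' - u * q'' - 1)
    (hcross : q'' + 1 = q' → (oedL n a r q' : ℤ) + 1 ≤ u)
    (h : PairBound n a t p q S u v (r + 1) p' q') :
    MeetBound n a t p q S v D r ∨
      ∃ p'', p'' < q'' ∧ p' ≤ p'' + 1 ∧ PairBound n a t p q S u v r p'' q'' := by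
  obtain ⟨p'', hp1, hp2, hlow, hpc⟩ := exists_neighbor_lower n (oedL n a r) (by omega : p' < n) hv
  have hinj := injCount_add_round a hr S
  have hI := cumLoad_sub_le (a (r + 1)) hpq.le hS
  have hQq := cumLoad_oedL_succ n a r q'
  have hQp := cumLoad_oedL_succ n a r p'
  unfold PairBound at h
  rw [hQq, hQp] at h
  rcases lt_trichotomy p'' q'' with hlt | heq | hgt
  · right
    refine ⟨p'', hlt, hp2, ?_⟩
    unfold PairBound
    rw [hinj]
    push_cast at h hI ⊢
    linarith
  · left
    subst heq
    unfold MeetBound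
    rw [hinj]
    push_cast at h hI ⊢
    linarith
  · left
    obtain ⟨rfl, hq'⟩ : p'' = p' + 1 ∧ q' = p' + 1 := by omega
    subst hq'
    have h1 := hpc rfl
    have hF : (oedF n (oedL n a r) p' : ℤ) ≤ 1 := by
      exact_mod_cast oedF_le_one n _ p'
    have hs := cumLoad_succ (oedL n a r) p'
    unfold MeetBound
    rw [hinj]
    push_cast at h hI hD ⊢
    have : (0 : ℤ) ≤ oedF n (oedL n a r) (p' + 1) := by positivity
    linarith

/-- Tracking the interval `(p, q]` back in time with an odd tilt `u` on the right and the two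
even tilts `u ± Δ` on the left: either the end points meet while the right one stays within
distance `w` of `q`, or the right one escapes in the favourable direction, or the tracked
interval becomes wide. -/
lemma trace_back (n : ℕ) (a : ℕ → ℕ → ℕ) {t p q w W : ℕ} {S : Finset ℕ} {u Δ : ℤ}
    (hpq : p < q) (hqn : q ≤ n) (hw : 1 ≤ w) (hW : 1 ≤ W)
    (hS : Finset.Ioc (p - W) (min n (q + w)) ⊆ S)
    (hu : Odd u) (hu1 : 1 ≤ u) (hΔ : 0 ≤ Δ) (hΔu : Δ ≤ u) (hodd : Odd Δ) :
    ∃ s ≤ t, ∃ v, (v = u - Δ ∨ v = u + Δ) ∧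
      (MeetBound n a t p q S v (Δ * w) s ∨
        (s < t ∧ ∃ p' q', p' < q' ∧ q' ≤ n ∧ PairBound n a t p q S u v s p' q' ∧
          ((u - v) * ((q : ℤ) - q') ≤ - (Δ * w) ∨
            ((u - v) * ((q : ℤ) - q') ≤ Δ * w ∧ (q : ℤ) - p + W - w ≤ (q' : ℤ) - p')))) := by
  by_contra hcon
  push Not at hcon
  have hevA : Even (u + Δ) := hu.add_odd hodd
  have hevB : Even (u - Δ) := hu.sub_odd hodd
  have state : ∀ k s, s + k = t → ∃ q' pA pB : ℕ, q' ≤ n ∧ (q : ℤ) - w < q' ∧ (q' : ℤ) < q + w ∧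
      (p : ℤ) - W < pA ∧ pA < q' ∧ (p : ℤ) - W < pB ∧ pB < q' ∧
      PairBound n a t p q S u (u + Δ) s pA q' ∧ PairBound n a t p q S u (u - Δ) s pB q' := by
    intro k
    induction k with
    | zero =>
      intro s hs
      obtain rfl : s = t := by omega
      refine ⟨q, p, p, hqn, by omega, by omega, by omega, hpq, by omega, hpq, ?_, ?_⟩ <;>
      · simp [PairBound, injCount]
    | succ k ih =>
      intro s hs
      obtain ⟨q', pA, pB, hq'n, hql, hqr, hpA, hpAq, hpB, hpBq, hA, hB⟩ := ih (s + 1) (by omega)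
      have hst : s < t := by omega
      obtain ⟨q'', hq''n, h1, h2, hup, hcr⟩ :=
        exists_neighbor_upper n (oedL n a s) (by omega : 1 ≤ q') hq'n hu hu1
      have hl : (q : ℤ) - w ≤ q'' := by omega
      have hr : (q'' : ℤ) ≤ q + w := by omega
      have m1 : Δ * ((q : ℤ) - q') ≤ Δ * w := mul_le_mul_of_nonneg_left (by omega) hΔ
      have m2 : Δ * ((q' : ℤ) - q) ≤ Δ * w := mul_le_mul_of_nonneg_left (by omega) hΔ
      have m3 : Δ * ((q : ℤ) - q'') ≤ Δ * w := mul_le_mul_of_nonneg_left (by omega) hΔ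
      have m4 : Δ * ((q'' : ℤ) - q) ≤ Δ * w := mul_le_mul_of_nonneg_left (by omega) hΔ
      have sub : ∀ x : ℕ, (p : ℤ) - W < x → Finset.Ioc x q' ⊆ S := fun x hx =>
        (Finset.Ioc_subset_Ioc (by omega) (le_min hq'n (by omega))).trans hS
      obtain ⟨hmA, hcA⟩ := hcon s hst.le (u + Δ) (Or.inr rfl)
      obtain ⟨hmB, hcB⟩ := hcon s hst.le (u - Δ) (Or.inl rfl)
      obtain ⟨pA', a1, a2, hA'⟩ := (PairBound.step (D := Δ * w) hst hevA hpAq hq'n (sub _ hpA)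
        (by linarith) (by linarith) h2 hup hcr hA).resolve_left hmA
      obtain ⟨pB', b1, b2, hB'⟩ := (PairBound.step (D := Δ * w) hst hevB hpBq hq'n (sub _ hpB)
        (by linarith) (by linarith) h2 hup hcr hB).resolve_left hmB
      obtain ⟨eA, wA⟩ := hcA hst pA' q'' a1 hq''n hA'
      obtain ⟨eB, wB⟩ := hcB hst pB' q'' b1 hq''n hB'
      have wA := wA (by linarith)
      have wB := wB (by linarith)
      refine ⟨q'', pA', pB', hq''n, ?_, ?_, by omega, a1, by omega, b1, hA', hB'⟩
      · refine lt_of_le_of_ne hl fun h => ?_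
        have : (q : ℤ) - q'' = w := by linarith
        rw [this] at eA
        linarith
      · refine lt_of_le_of_ne hr fun h => ?_
        have : (q : ℤ) - q'' = - w := by linarith
        rw [this] at eB
        linarith
  obtain ⟨q', pA, pB, -, hql, hqr, -, -, -, hlt, -, hB⟩ := state t 0 (by omega)
  apply (hcon 0 (Nat.zero_le _) (u - Δ) (Or.inl rfl)).1
  have h0 : ∀ i, cumLoad (oedL n a 0) i = 0 := fun i => by simp [cumLoad, oedL]
  unfold PairBound at hB
  rw [h0, h0] at hB
  unfold MeetBound
  have m1 : Δ * ((q : ℤ) - q') ≤ Δ * w := mul_le_mul_of_nonneg_left (by omega) hΔ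
  have m2 : 0 ≤ (u - Δ) * ((q' : ℤ) - pB) := mul_nonneg (by linarith) (by omega)
  linarith

/-- The load allowance of an interval of length `x`, beyond the excess of the injections. -/
noncomputable def allowance (n : ℕ) (Δ x : ℝ) : ℝ := 8 * Δ * (x * (1 + Real.log (n / x)))

lemma log_div_le_tangent {n x y : ℝ} (hn : 0 < n) (hx : 0 < x) (hy : 0 < y) :
    y * (1 + Real.log (n / y)) ≤ Real.log (n / x) * y + x := by
  have h := Real.log_le_sub_one_of_pos (div_pos hx hy)
  have e : Real.log (n / y) = Real.log (n / x) + Real.log (x / y) := by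
    rw [← Real.log_mul (by positivity) (by positivity)]
    congr 1
    field_simp
  have h2 : y * Real.log (x / y) ≤ y * (x / y - 1) := mul_le_mul_of_nonneg_left h hy.le
  have h3 : y * (x / y - 1) = x - y := by field_simp
  rw [e]
  linarith

lemma log_div_le_of_wide {n x y : ℝ} (hn : 0 < n) (hx : 0 < x) (hy : 5 * x ≤ y) :
    y * (1 + Real.log (n / y)) ≤ Real.log (n / x) * y := by
  have hy0 : 0 < y := by linarith
  have h1 : 1 + Real.log (n / y) ≤ Real.log (n / x) := by
    have e : Real.log (n / x) = Real.log (n / y) + Real.log (y / x) := by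
      rw [← Real.log_mul (by positivity) (by positivity)]
      congr 1
      field_simp
    have : 1 ≤ Real.log (y / x) := by
      rw [Real.le_log_iff_exp_le (by positivity)]
      have h5 : (5 : ℝ) ≤ y / x := by rwa [le_div_iff₀ hx]
      linarith [Real.exp_one_lt_d9]
    linarith
  rw [mul_comm]
  exact mul_le_mul_of_nonneg_right h1 hy0.le

lemma cumLoad_sub_le_allowance (n : ℕ) (a : ℕ → ℕ → ℕ) {B : ℝ} (hB : 0 ≤ B) {Δ : ℕ}
    (hodd : Odd Δ) (hΔ : 13 * B + 3 ≤ Δ) (t : ℕ) :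
    ∀ p q : ℕ, p ≤ q → q ≤ n → ∃ s ≤ t, ∃ S ⊆ Finset.Icc 1 n,
      ((cumLoad (oedL n a t) q - cumLoad (oedL n a t) p : ℤ) : ℝ)
        ≤ allowance n Δ ((q : ℝ) - p) + injCount a s t S - ((t : ℝ) - s) - B * S.card := by
  induction t using Nat.strong_induction_on with
  | _ t ih =>
  intro p q hpq hqn
  rcases hpq.eq_or_lt with rfl | hlt
  · exact ⟨t, le_rfl, ∅, by simp, by simp [allowance, injCount]⟩
  obtain ⟨l, rfl⟩ : ∃ l, q = p + l := ⟨q - p, by omega⟩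
  have hl1 : 1 ≤ l := by omega
  have hl0 : (1 : ℝ) ≤ l := by exact_mod_cast hl1
  have hn0 : (0 : ℝ) < n := by exact_mod_cast (by omega : 0 < n)
  have hln : (l : ℝ) ≤ n := by exact_mod_cast (by omega : l ≤ n)
  set g : ℝ := Real.log (n / l) with hg
  have hg0 : 0 ≤ g := Real.log_nonneg (by rw [le_div_iff₀ (by linarith)]; linarith)
  have hΔ0 : (0 : ℝ) ≤ Δ := by positivity
  set c : ℤ := ⌈4 * Δ * g⌉ with hc
  have hc0 : 0 ≤ c := Int.ceil_nonneg (by positivity)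
  have hc1 : 4 * Δ * g ≤ c := Int.le_ceil _
  have hc2 : (c : ℝ) < 4 * Δ * g + 1 := Int.ceil_lt_add_one _
  have hΔodd : Odd (Δ : ℤ) := by exact_mod_cast hodd
  have hΔpos : (1 : ℤ) ≤ Δ := by exact_mod_cast hodd.pos
  set S := Finset.Ioc (p - 8 * l) (min n (p + l + 4 * l)) with hS
  have hSn : S ⊆ Finset.Icc 1 n := fun x hx => by
    rw [hS, Finset.mem_Ioc, le_min_iff] at hx
    rw [Finset.mem_Icc]; omega
  have hcard : (S.card : ℝ) ≤ 13 * l := by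
    have : S.card ≤ 13 * l := by rw [hS, Nat.card_Ioc]; omega
    exact_mod_cast this
  have hBS : B * S.card ≤ 13 * B * l := by nlinarith
  have hall : allowance n Δ (((p + l : ℕ) : ℝ) - p) = 8 * Δ * (g * l + l) := by
    simp only [allowance, Nat.cast_add, add_sub_cancel_left, ← hg]
    ring
  have hslack : (13 * B + 3) * l ≤ Δ * l := mul_le_mul_of_nonneg_right hΔ (by linarith)
  have hBl : 0 ≤ B * l := by positivity
  rw [hall]
  obtain ⟨s, hst, v, hv, hcase⟩ := trace_back n a (t := t) (p := p) (q := p + l) (w := 4 * l)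
    (W := 8 * l) (S := S) (u := 2 * c + Δ) (Δ := Δ) hlt hqn (by omega) (by omega) subset_rfl
    ((even_two_mul c).add_odd hΔodd) (by omega) (by omega) (by omega)
    hΔodd
  have hvlo : 8 * Δ * g ≤ v := by
    rcases hv with rfl | rfl <;> push_cast <;> linarith
  have hvhi : (v : ℝ) ≤ 8 * Δ * g + 2 + 2 * Δ := by
    rcases hv with rfl | rfl <;> push_cast <;> linarith
  have hvl : (v : ℝ) * l ≤ (8 * Δ * g + 2 + 2 * Δ) * l :=
    mul_le_mul_of_nonneg_right hvhi (by linarith)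
  rcases hcase with hmeet | ⟨hs, p', q', hpq', hqn', hpair, hesc⟩
  · refine ⟨s, hst, S, hSn, ?_⟩
    unfold MeetBound at hmeet
    have hmeet' := (Int.cast_le (R := ℝ)).mpr hmeet
    push_cast at hmeet' ⊢
    linarith
  · obtain ⟨s₀, hs₀, S₀, hS₀, hprev⟩ := ih s hs p' q' hpq'.le hqn'
    refine ⟨s₀, hs₀.trans hst, S₀ ∪ S, Finset.union_subset hS₀ hSn, ?_⟩
    have hinj : (injCount a s₀ s S₀ : ℝ) + injCount a s t S ≤ injCount a s₀ t (S₀ ∪ S) := by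
      exact_mod_cast injCount_concat a hs₀ hst S₀ S
    have hunion : B * (S₀ ∪ S).card ≤ B * S₀.card + B * S.card := by
      rw [← mul_add]
      exact mul_le_mul_of_nonneg_left (by exact_mod_cast Finset.card_union_le S₀ S) hB
    have hlen : (0 : ℝ) < (q' : ℝ) - p' := by
      have : (p' : ℝ) < q' := by exact_mod_cast hpq'
      linarith
    have hvl' : 8 * Δ * g * ((q' : ℝ) - p') ≤ v * ((q' : ℝ) - p') :=
      mul_le_mul_of_nonneg_right hvlo hlen.le
    unfold PairBound at hpair
    have hpair' := (Int.cast_le (R := ℝ)).mpr hpair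
    rcases hesc with hesc | ⟨hesc, hwide⟩
    · have htan := log_div_le_tangent hn0 (by linarith : (0 : ℝ) < l) hlen
      have htan' := mul_le_mul_of_nonneg_left htan (by positivity : (0 : ℝ) ≤ 8 * Δ)
      have hesc' := (Int.cast_le (R := ℝ)).mpr hesc
      unfold allowance at hprev
      rw [← hg] at htan'
      push_cast at hpair' hesc' hprev ⊢
      linarith
    · have hwide' : 5 * (l : ℝ) ≤ (q' : ℝ) - p' := by
        have := (Int.cast_le (R := ℝ)).mpr hwide
        push_cast at this
        linarith
      have htan := log_div_le_of_wide hn0 (by linarith : (0 : ℝ) < l) hwide'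
      have htan' := mul_le_mul_of_nonneg_left htan (by positivity : (0 : ℝ) ≤ 8 * Δ)
      have hesc' := (Int.cast_le (R := ℝ)).mpr hesc
      unfold allowance at hprev
      rw [← hg] at htan'
      push_cast at hpair' hesc' hprev ⊢
      linarith

lemma injCount_le_of_LBPath {n : ℕ} (hn : 1 ≤ n) {a : ℕ → ℕ → ℕ} {ρ σ B : ℝ} (hρ : ρ ≤ 1)
    (h : LBPath n a ρ σ (fun _ => B)) {s t : ℕ} (hst : s ≤ t) {S : Finset ℕ}
    (hS : S ⊆ Finset.Icc 1 n) :
    (injCount a s t S : ℝ) ≤ ((t : ℝ) - s) + σ + B * S.card := by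
  have h' := h (s + 1) t S hS n (Finset.mem_Icc.mpr ⟨hn, le_rfl⟩)
  rw [Finset.filter_true_of_mem fun i hi => (Finset.mem_Icc.mp (hS hi)).2] at h'
  have hI : Finset.Icc (s + 1) t = Finset.Ioc s t := by ext x; simp
  have hc : ((Finset.Ioc s t).card : ℝ) = (t : ℝ) - s := by
    rw [Nat.card_Ioc, Nat.cast_sub hst]
  rw [hI, hc, Finset.sum_const, nsmul_eq_mul] at h'
  have hts : (0 : ℝ) ≤ (t : ℝ) - s := by
    have : (s : ℝ) ≤ t := by exact_mod_cast hst
    linarith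
  unfold injCount
  nlinarith

/-- there is a universal constant `c > 0` such that for every `n ≥ 1`,
`ρ ≤ 1`, `σ, B ≥ 0`, and every locally `(ρ, σ, B)`-bounded injection pattern on the
single-destination path of size `n`, the OED loads satisfy
`sup_{t,i} L(t,i) ≤ c·((B+1)·log₂(n+1) + σ + 1)`. -/
theorem stmt5 :
    ∃ c : ℝ, 0 < c ∧
      ∀ n : ℕ, 1 ≤ n → ∀ ρ σ B : ℝ, ρ ≤ 1 → 0 ≤ σ → 0 ≤ B →
        ∀ a : ℕ → ℕ → ℕ, pathSupp n a → LBPath n a ρ σ (fun _ => B) →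
          ∀ t : ℕ, ∀ i ∈ Finset.Icc 1 n,
            (oedL n a t i : ℝ)
              ≤ c * ((B + 1) * Real.logb 2 ((n : ℝ) + 1) + σ + 1) := by
  refine ⟨208, by norm_num, ?_⟩
  intro n hn ρ σ B hρ hσ hB a _ hLB t i hi
  obtain ⟨hi1, hin⟩ := Finset.mem_Icc.mp hi
  obtain ⟨m, rfl⟩ : ∃ m, i = m + 1 := ⟨i - 1, by omega⟩
  set Δ : ℕ := 2 * ⌈(13 * B + 3) / 2⌉₊ + 1 with hΔ
  have hΔlo : 13 * B + 3 ≤ (Δ : ℝ) := by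
    have := Nat.le_ceil ((13 * B + 3) / 2)
    rw [hΔ]; push_cast; linarith
  have hΔhi : (Δ : ℝ) ≤ 13 * (B + 1) := by
    have := Nat.ceil_lt_add_one (by linarith : 0 ≤ (13 * B + 3) / 2)
    rw [hΔ]; push_cast; linarith
  obtain ⟨s, hst, S, hS, hload⟩ := cumLoad_sub_le_allowance n a hB (Δ := Δ) (odd_two_mul_add_one _)
    hΔlo t    m (m + 1) (Nat.le_succ m) hin
  have hinj := injCount_le_of_LBPath hn hρ hLB hst hS
  rw [cumLoad_succ, add_sub_cancel_left] at hload
  simp only [allowance, Nat.cast_add, Nat.cast_one, add_sub_cancel_left, Int.cast_natCast, div_one,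
    one_mul] at hload
  have hn1 : (1 : ℝ) ≤ n := by exact_mod_cast hn
  have hone : 1 ≤ Real.logb 2 ((n : ℝ) + 1) := by
    rw [Real.le_logb_iff_rpow_le (by norm_num) (by linarith), Real.rpow_one]
    linarith
  have hlog : Real.log n ≤ Real.logb 2 ((n : ℝ) + 1) := by
    have h1 : Real.log n ≤ Real.log (n + 1) := Real.log_le_log (by linarith) (by linarith)
    have h2 : 0 < Real.log 2 := Real.log_pos (by norm_num)
    have h3 : Real.log 2 ≤ 1 := by linarith [Real.log_two_lt_d9]
    have h4 : 0 ≤ Real.log ((n : ℝ) + 1) := Real.log_nonneg (by linarith)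
    rw [Real.logb, le_div_iff₀ h2]
    nlinarith
  have hmain : (Δ : ℝ) * (1 + Real.log n)
      ≤ 13 * (B + 1) * (2 * Real.logb 2 ((n : ℝ) + 1)) :=
    mul_le_mul hΔhi (by linarith) (by linarith [Real.log_nonneg hn1]) (by linarith)
  linarith
end

section
/- Let L : {1, …, n} → ℕ be a load configuration on the single-destination path (with L(n+1) = 0), let F(i) ∈ {0, 1} be the OED forwarding decisions for L (F(i) = 1 iff L(i) > L(i+1), or L(i) = L(i+1) and L(i) is odd), and let L'(i) = L(i) − F(i) + F(i−1) (with F(0) = 0) be the configuration after one OED forwarding step. If h is an even natural number and I = [a, b] is an interval of buffers with L(i) ≥ h for all i ∈ [a, b], then L'(i) ≥ h for all i ∈ [a, b−1]. -/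
/-- Away from the end of the path, the forwarding decision does not involve the
convention for buffer `n + 1`. -/
theorem oedF_of_succ_le {n : ℕ} {L : ℕ → ℕ} {i : ℕ} (hi : 1 ≤ i) (hin : i + 1 ≤ n) :
    oedF n L i = if L (i + 1) < L i ∨ (L i = L (i + 1) ∧ Odd (L i)) then 1 else 0 := by
  simp [oedF, hi, hin, Nat.le_of_succ_le hin]

/-- persistence of even plateaus: if every buffer of the interval
`[a, b] ⊆ {1, …, n}` has load at least an even number `h`, then after one OED
forwarding step every buffer of `[a, b−1]` still has load at least `h`. -/
theorem stmt6 (n : ℕ) (L : ℕ → ℕ) (h a b : ℕ) (hh : Even h)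
    (ha : 1 ≤ a) (hb : b ≤ n)
    (hI : ∀ i ∈ Finset.Icc a b, h ≤ L i) :
    ∀ i ∈ Finset.Icc a (b - 1), h ≤ L i - oedF n L i + oedF n L (i - 1) := by
  intro i hi
  rw [Finset.mem_Icc] at hi
  have hLi : h ≤ L i := hI i (Finset.mem_Icc.2 (by omega))
  have hLs : h ≤ L (i + 1) := hI (i + 1) (Finset.mem_Icc.2 (by omega))
  rw [oedF_of_succ_le (by omega) (by omega)]
  rw [← Nat.not_odd_iff_even] at hh
  split_ifs with hF
  · have hne : L i ≠ h := by
      rintro rfl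
      exact hF.elim (by omega) fun hF => hh hF.2
    omega
  · omega
end

section
/- On the single-destination path of size n, let A₀ be the injection pattern that, at each round t ∈ {1, n+1, 2n+1, …}, injects exactly n packets into buffer 1 (and injects nothing at all other rounds and into all other buffers). Then A₀ is (1, n − 1)-bounded; however, if A₀ is locally (1, σ, β)-bounded for some σ ≥ 0 and β : {1, …, n} → ℝ≥0, then σ + β(1) ≥ n − 1. -/
/-- The injection pattern `A₀` on the single-destination path of size `n`: at each
round `t ∈ {1, n+1, 2n+1, …}`, `n` packets are injected into buffer `1`, and nothing
is injected at other rounds or into other buffers. -/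
def injA0 (n : ℕ) : ℕ → ℕ → ℕ :=
  fun t i => if 1 ≤ t ∧ t % n = 1 % n ∧ i = 1 then n else 0

/-- The number of packets injected by `A₀` in the rounds up to `k` is `n ⌈k / n⌉`. -/
theorem sum_range_injA0 (n : ℕ) (hn : 1 ≤ n) (k : ℕ) :
    ∑ r ∈ Finset.range (k + 1), injA0 n r 1 = n * ((k + n - 1) / n) := by
  induction k with
  | zero => simp [injA0, Nat.div_eq_of_lt (Nat.sub_lt hn one_pos)]
  | succ k ih =>
    have h_mod : (k + 1) % n = 1 % n ↔ n ∣ k + n := by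
      rw [Nat.dvd_add_self_right, ← Nat.modEq_zero_iff_dvd]
      exact ⟨fun h => Nat.ModEq.add_right_cancel' 1 (by simpa [Nat.ModEq] using h),
        fun h => by simpa [Nat.ModEq] using h.add_right 1⟩
    have h_succ : k + 1 + n - 1 = k + n - 1 + 1 := by omega
    have h_add : k + n - 1 + 1 = k + n := by omega
    rw [Finset.sum_range_succ, ih, h_succ, Nat.succ_div, h_add]
    by_cases h : n ∣ k + n <;> simp [injA0, h_mod, h, mul_add]

theorem sum_Icc_injA0_le (n : ℕ) (hn : 1 ≤ n) (s t : ℕ) :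
    ∑ r ∈ Finset.Icc s t, injA0 n r 1 ≤ (Finset.Icc s t).card + (n - 1) := by
  rcases lt_or_ge t s with hst | hst
  · simp [Finset.Icc_eq_empty_of_lt hst]
  have h_split : ∑ r ∈ Finset.range s, injA0 n r 1 + ∑ r ∈ Finset.Icc s t, injA0 n r 1
      = ∑ r ∈ Finset.range (t + 1), injA0 n r 1 := by
    rw [← Finset.Ico_add_one_right_eq_Icc]
    exact Finset.sum_range_add_sum_Ico _ (by omega)
  have h_upper : ∑ r ∈ Finset.range (t + 1), injA0 n r 1 ≤ t + n - 1 := by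
    rw [sum_range_injA0 n hn]
    exact Nat.mul_div_le _ _
  have h_lower : s ≤ ∑ r ∈ Finset.range s, injA0 n r 1 + 1 := by
    cases s with
    | zero => simp
    | succ k =>
      rw [sum_range_injA0 n hn]
      have h_lt := Nat.lt_mul_div_succ (k + n - 1) hn
      rw [mul_add] at h_lt
      omega
  rw [Nat.card_Icc]
  omega

/-- `A₀` is `(1, n − 1)`-bounded, but `A₀` is locally
`(1, σ, β)`-bounded only when `σ + β(1) ≥ n − 1`. -/
theorem stmt15 (n : ℕ) (hn : 1 ≤ n) :
    BPath n (injA0 n) 1 ((n : ℝ) - 1) ∧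
    ∀ (σ : ℝ) (β : ℕ → ℝ), 0 ≤ σ → (∀ i, 0 ≤ β i) →
      LBPath n (injA0 n) 1 σ β → (n : ℝ) - 1 ≤ σ + β 1 := by
  have h_one (r : ℕ) (S : Finset ℕ) (hS : 1 ∈ S) : ∑ i ∈ S, injA0 n r i = injA0 n r 1 :=
    Finset.sum_eq_single_of_mem 1 hS fun i _ hi => by simp [injA0, hi]
  refine ⟨fun s t e he => ?_, fun σ β _ _ h => ?_⟩
  · have h_mem : 1 ∈ (Finset.Icc 1 n).filter (fun i => i ≤ e) := by
      simp only [Finset.mem_filter, Finset.mem_Icc] at he ⊢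
      omega
    rw [Finset.sum_congr rfl fun r _ => h_one r _ h_mem]
    have h_le : ((∑ r ∈ Finset.Icc s t, injA0 n r 1 : ℕ) : ℝ)
        ≤ ((Finset.Icc s t).card + (n - 1) : ℕ) := by
      exact_mod_cast sum_Icc_injA0_le n hn s t
    rw [Nat.cast_add, Nat.cast_sub hn, Nat.cast_one] at h_le
    linarith
  · have h_burst := h 1 1 {1} (by simpa using hn) 1 (by simpa using hn)
    simp [Finset.filter_singleton, injA0] at h_burst
    linarith
end

section
/- Let (A_k)_{k ≥ 1} be injection patterns on the single-destination path of size n such that: each A_k injects packets only during a window W_k of rounds; each A_k, viewed on its own, is locally (1, σ, B)-bounded; each A_k injects at most Bn + σ packets in total; and for every k, every round in W_{k+1} exceeds every round in W_k by more than Bn + σ (i.e., consecutive windows are separated by at least Bn + σ rounds with no injections). Then the combined injection pattern A = Σ_k A_k is locally (1, σ, B)-bounded. -/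
/-- if each `A k` injects only during a window `[lo k, hi k]` of rounds,
is locally `(1, σ, B)`-bounded, injects at most `Bn + σ` packets in total, and
consecutive windows are separated by more than `Bn + σ` rounds, then the combined
injection pattern `∑ k, A k` is locally `(1, σ, B)`-bounded.  (Since round `t` can
only belong to windows `W k` with `k ≤ t`, the combined pattern at round `t` is
`∑_{k ≤ t} A k t i`.) -/
theorem stmt18 (n : ℕ) (σ B : ℝ) (hσ : 0 ≤ σ) (hB : 0 ≤ B)
    (A : ℕ → ℕ → ℕ → ℕ) (lo hi : ℕ → ℕ)
    (hwin : ∀ k, lo k ≤ hi k)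
    (hsep : ∀ k, (hi k : ℝ) + (B * n + σ) < lo (k + 1))
    (hin : ∀ k t i, ¬(lo k ≤ t ∧ t ≤ hi k) → A k t i = 0)
    (hsupp : ∀ k, pathSupp n (A k))
    (hbd : ∀ k, LBPath n (A k) 1 σ (fun _ => B))
    (htot : ∀ k, ∀ T : Finset ℕ,
      ((∑ t ∈ T, ∑ i ∈ Finset.Icc 1 n, A k t i : ℕ) : ℝ) ≤ B * n + σ) :
    LBPath n (fun t i => ∑ k ∈ Finset.range (t + 1), A k t i) 1 σ (fun _ => B) := by
  have hnn : 0 ≤ B * n + σ := by positivity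
  have hstep : ∀ k, hi k < lo (k + 1) := fun k => by
    have := hsep k
    exact_mod_cast (by linarith : (hi k : ℝ) < lo (k + 1))
  have hmono : StrictMono lo := strictMono_nat_of_lt_succ fun k => (hwin k).trans_lt (hstep k)
  intro s t S hS e he
  set S' := S.filter (fun i => i ≤ e)
  have hS'n : S' ⊆ Finset.Icc 1 n := (Finset.filter_subset _ _).trans hS
  let F : ℕ → ℕ := fun k => ∑ r ∈ Finset.Icc s t, ∑ i ∈ S', A k r i
  have hswap : ∑ r ∈ Finset.Icc s t, ∑ i ∈ S', ∑ k ∈ Finset.range (r + 1), A k r i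
      = ∑ k ∈ Finset.range (t + 1), F k := by
    rw [Finset.sum_comm (s := Finset.range (t + 1))]
    refine Finset.sum_congr rfl fun r hr => ?_
    rw [Finset.sum_comm (s := Finset.range (t + 1))]
    refine Finset.sum_congr rfl fun i _ => ?_
    refine Finset.sum_subset ?_ fun k _ hk => hin k r i fun h => ?_
    · have := (Finset.mem_Icc.1 hr).2
      exact Finset.range_subset_range.2 (by omega)
    · have := hmono.le_apply (x := k)
      simp only [Finset.mem_range] at hk
      omega
  have hFtot : ∀ k, (F k : ℝ) ≤ B * n + σ := fun k => by
    refine le_trans ?_ (htot k (Finset.Icc s t))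
    exact_mod_cast Finset.sum_le_sum fun r _ => Finset.sum_le_sum_of_subset hS'n
  have hFzero : ∀ k, hi k < s ∨ t < lo k → F k = 0 := fun k h =>
    Finset.sum_eq_zero fun r hr => Finset.sum_eq_zero fun i _ => hin k r i fun h' => by
      have := Finset.mem_Icc.1 hr
      omega
  have hpast : ∀ m, ((∑ k ∈ Finset.range m, F k : ℕ) : ℝ) ≤ max 0 ((lo m : ℝ) - s) := by
    intro m
    induction m with
    | zero => simp
    | succ m ih =>
      rw [Finset.sum_range_succ, Nat.cast_add]
      have hw : (lo m : ℝ) ≤ hi m := by exact_mod_cast hwin m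
      rcases lt_or_ge (hi m) s with h | h
      · have h' : (hi m : ℝ) < s := by exact_mod_cast h
        rw [max_eq_left (by linarith)] at ih
        rw [hFzero m (Or.inl h)]
        exact le_max_of_le_left (by simpa using ih)
      · have h' : (s : ℝ) ≤ hi m := by exact_mod_cast h
        have hm : max 0 ((lo m : ℝ) - s) ≤ hi m - s := max_le (by linarith) (by linarith)
        refine le_max_of_le_right ?_
        linarith [hsep m, hFtot m]
  have hcur : ∀ m, (F m : ℝ) ≤
      (Finset.Icc (max s (lo m)) t).card + σ + ∑ i ∈ S, B := fun m => by
    have h := hbd m (max s (lo m)) t S hS e he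
    rw [one_mul] at h
    refine le_of_eq_of_le ?_ h
    congr 1
    symm
    refine Finset.sum_subset (Finset.Icc_subset_Icc_left (le_max_left _ _)) fun r hr hr' => ?_
    refine Finset.sum_eq_zero fun i _ => hin m r i fun h' => hr' ?_
    have := Finset.mem_Icc.1 hr
    exact Finset.mem_Icc.2 ⟨max_le this.1 h'.1, this.2⟩
  have hBS : 0 ≤ ∑ i ∈ S, B := Finset.sum_nonneg fun _ _ => hB
  have hmain : ∀ m, ((∑ k ∈ Finset.range m, F k : ℕ) : ℝ) ≤
      (Finset.Icc s t).card + σ + ∑ i ∈ S, B := by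
    intro m
    induction m with
    | zero =>
      rw [Finset.sum_range_zero, Nat.cast_zero]
      positivity
    | succ m ih =>
      rw [Finset.sum_range_succ]
      rcases lt_or_ge t (lo m) with h | h
      · rwa [hFzero m (Or.inr h), add_zero]
      · have hp := hpast m
        have hc := hcur m
        rw [Nat.cast_add]
        rcases le_total s (lo m) with hs | hs
        · have hs' : (s : ℝ) ≤ lo m := by exact_mod_cast hs
          rw [max_eq_right (by linarith)] at hp
          rw [max_eq_right hs] at hc
          have hcard : (Finset.Icc s t).card + s = (Finset.Icc (lo m) t).card + lo m := by
            simp only [Nat.card_Icc]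
            omega
          have hcard' : ((Finset.Icc s t).card : ℝ) + s = (Finset.Icc (lo m) t).card + lo m := by
            exact_mod_cast hcard
          linarith
        · have hs' : (lo m : ℝ) ≤ s := by exact_mod_cast hs
          rw [max_eq_left (by linarith)] at hp
          rw [max_eq_left hs] at hc
          linarith
  rw [one_mul, hswap]
  exact hmain (t + 1)
end

section
/- Let B ≥ 1, m ≥ 1, n = (2B)^m, and fix any deterministic online forwarding protocol F on the unit-capacity single-destination path of size n and any initial load configuration. Draw i uniformly at random from {1, …, n}, and let I₀ = {1, …, n} ⊇ I₁ ⊇ ⋯ ⊇ I_m be the nested intervals containing i, where I_j is the j-th level block of the recursive subdivision of I₀ into 2B consecutive equal parts (so |I_j| = n/(2B)^j). Run one epoch against F: for j = 1, …, m, at the start of phase j inject B packets into every buffer of I_j and then let F run for τ_j = |I_j|/2 forwarding rounds. Call phase j good if, at the beginning of phase j (before its injections), the average load of I_j is at least the average load of I_{j−1}, and call the epoch good if all m phases are good. Then the probability that the epoch is good is at least 1/n. -/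
/-- `blockSize B m j = (2B)^(m−j)` : the size of a level-`j` block of the recursive
subdivision of `{1, …, (2B)^m}` into `2B` consecutive equal parts. -/
def blockSize (B m j : ℕ) : ℕ := (2 * B) ^ (m - j)

/-- The left endpoint of the level-`j` block containing buffer `i`. -/
def blockLo (B m j i : ℕ) : ℕ := ((i - 1) / blockSize B m j) * blockSize B m j + 1

/-- `I_j` : the level-`j` block of buffers containing buffer `i`
(`I_0 = {1, …, (2B)^m}`). -/
def blockOf (B m j i : ℕ) : Finset ℕ :=
  Finset.Icc (blockLo B m j i) (blockLo B m j i + blockSize B m j - 1)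

/-- The round at which phase `j` of the epoch starts: phase `1` starts at round `0`,
and phase `j` is followed by `τ_j = |I_j| / 2` forwarding rounds. -/
def phaseStart (B m j : ℕ) : ℕ := ∑ l ∈ Finset.Icc 1 (j - 1), blockSize B m l / 2

/-- The epoch's injection pattern determined by the random buffer `i`: at the start of
each phase `j ∈ {1, …, m}`, `B` packets are injected into every buffer of `I_j`. -/
def epInj (B m i : ℕ) : ℕ → ℕ → ℕ := fun t j' =>
  ∑ _j ∈ (Finset.Icc 1 m).filter
      (fun j => t = phaseStart B m j ∧ j' ∈ blockOf B m j i), B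

/-- The loads produced by the forwarding protocol `Fp` on the injection pattern `a`,
starting from the initial load configuration `L0`:
`L(0, i) = L0 i + a 0 i` and `L(t+1, i) = L(t, i) − F(t, i) + F(t, i−1) + a(t+1, i)`. -/
def protLW (n : ℕ) (Fp : ℕ → (ℕ → ℕ → ℕ) → ℕ → ℕ) (L0 : ℕ → ℕ)
    (a : ℕ → ℕ → ℕ) : ℕ → ℕ → ℕ
  | 0 => fun i => L0 i + a 0 i
  | t + 1 => fun i =>
      protLW n Fp L0 a t i - Fp t a i + Fp t a (i - 1) + a (t + 1) i

/-- The load of buffer `i'` at round `t` before the injections of round `t`. -/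
def preLoad (n : ℕ) (Fp : ℕ → (ℕ → ℕ → ℕ) → ℕ → ℕ) (L0 : ℕ → ℕ)
    (a : ℕ → ℕ → ℕ) (t i' : ℕ) : ℕ :=
  protLW n Fp L0 a t i' - a t i'

/-- Phase `j` of the epoch determined by buffer `i` is good: at the beginning of phase
`j` (before its injections), the average load of `I_j` is at least the average load of
`I_{j−1}`. -/
def GoodPhase (n B m : ℕ) (Fp : ℕ → (ℕ → ℕ → ℕ) → ℕ → ℕ) (L0 : ℕ → ℕ)
    (i j : ℕ) : Prop :=
  ((∑ i' ∈ blockOf B m (j - 1) i,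
      preLoad n Fp L0 (epInj B m i) (phaseStart B m j) i' : ℕ) : ℝ)
      / blockSize B m (j - 1)
    ≤ ((∑ i' ∈ blockOf B m j i,
        preLoad n Fp L0 (epInj B m i) (phaseStart B m j) i' : ℕ) : ℝ)
        / blockSize B m j

/-- The epoch determined by buffer `i` is good: all of its `m` phases are good. -/
def GoodEpoch (n B m : ℕ) (Fp : ℕ → (ℕ → ℕ → ℕ) → ℕ → ℕ) (L0 : ℕ → ℕ)
    (i : ℕ) : Prop :=
  ∀ j ∈ Finset.Icc 1 m, GoodPhase n B m Fp L0 i j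

theorem phaseStart_mono (B m : ℕ) : Monotone (phaseStart B m) := by
  intro a b h
  unfold phaseStart
  exact Finset.sum_le_sum_of_subset (Finset.Icc_subset_Icc_right (by omega))

theorem blockOf_congr {B m j i i' : ℕ}
    (h : (i - 1) / blockSize B m j = (i' - 1) / blockSize B m j) :
    blockOf B m j i = blockOf B m j i' := by
  simp only [blockOf, blockLo, h]

/-- Injections before the start of phase `k + 1` depend only on the first `k` levels. -/
theorem epInj_congr {B m i i' k t : ℕ}
    (h : ∀ j ≤ k, blockOf B m j i = blockOf B m j i') (ht : t < phaseStart B m (k + 1)) :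
    epInj B m i t = epInj B m i' t := by
  funext x
  unfold epInj
  congr 1
  refine Finset.filter_congr fun j _ => and_congr_right fun hj => ?_
  rcases le_or_gt j k with hjk | hjk
  · rw [h j hjk]
  · have := phaseStart_mono B m (Nat.succ_le_of_lt hjk)
    simp only [Nat.succ_eq_add_one] at this
    omega

section Online

variable {n : ℕ} {Fp : ℕ → (ℕ → ℕ → ℕ) → ℕ → ℕ} {L0 : ℕ → ℕ}

theorem protLW_congr
    (honline : ∀ t : ℕ, ∀ a a' : ℕ → ℕ → ℕ, (∀ s ≤ t, a s = a' s) → Fp t a = Fp t a')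
    {a a' : ℕ → ℕ → ℕ} {t : ℕ} (h : ∀ s ≤ t, a s = a' s) :
    protLW n Fp L0 a t = protLW n Fp L0 a' t := by
  induction t with
  | zero => funext x; simp only [protLW, h 0 le_rfl]
  | succ t ih =>
    have hs : ∀ s ≤ t, a s = a' s := fun s hs => h s (by omega)
    funext x
    simp only [protLW, ih hs, honline t a a' hs, h (t + 1) le_rfl]

/-- The load before the injections of round `t` depends only on earlier injections. -/
theorem preLoad_congr
    (honline : ∀ t : ℕ, ∀ a a' : ℕ → ℕ → ℕ, (∀ s ≤ t, a s = a' s) → Fp t a = Fp t a')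
    {a a' : ℕ → ℕ → ℕ} {t : ℕ} (h : ∀ s < t, a s = a' s) :
    preLoad n Fp L0 a t = preLoad n Fp L0 a' t := by
  funext x
  cases t with
  | zero => simp [preLoad, protLW]
  | succ t =>
    have hs : ∀ s ≤ t, a s = a' s := fun s hs => h s (by omega)
    simp only [preLoad, protLW, protLW_congr honline hs, honline t a a' hs,
      Nat.add_sub_cancel]

theorem preLoad_epInj_congr
    (honline : ∀ t : ℕ, ∀ a a' : ℕ → ℕ → ℕ, (∀ s ≤ t, a s = a' s) → Fp t a = Fp t a')
    {B m i i' k j : ℕ} (h : ∀ j ≤ k, blockOf B m j i = blockOf B m j i') (hj : j ≤ k + 1) :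
    preLoad n Fp L0 (epInj B m i) (phaseStart B m j)
      = preLoad n Fp L0 (epInj B m i') (phaseStart B m j) :=
  preLoad_congr honline fun _ hs =>
    epInj_congr h (hs.trans_le (phaseStart_mono B m hj))

end Online

theorem sum_Icc_eq_sum_range (f : ℕ → ℕ) (x s : ℕ) :
    ∑ r ∈ Finset.Icc (x + 1) (x + 1 + s - 1), f r = ∑ r ∈ Finset.range s, f (x + 1 + r) := by
  have h : Finset.Icc (x + 1) (x + 1 + s - 1) = Finset.Ico (x + 1) (x + 1 + s) := by
    ext y; simp only [Finset.mem_Icc, Finset.mem_Ico]; omega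
  rw [h, Finset.sum_Ico_eq_sum_range, Nat.add_sub_cancel_left]

theorem sum_range_mul_eq (f : ℕ → ℕ) (c s : ℕ) :
    ∑ r ∈ Finset.range (c * s), f r
      = ∑ u ∈ Finset.range c, ∑ r ∈ Finset.range s, f (u * s + r) := by
  induction c with
  | zero => simp
  | succ c ih => rw [Nat.succ_mul, Finset.sum_range_add, ih, Finset.sum_range_succ]

/-- Some part of a subdivision into `c` equal parts has at least the average sum. -/
theorem exists_sum_range_mul_le (f : ℕ → ℕ) {c : ℕ} (hc : 0 < c) (s : ℕ) :
    ∃ u < c, ∑ r ∈ Finset.range (c * s), f r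
      ≤ c * ∑ r ∈ Finset.range s, f (u * s + r) := by
  obtain ⟨u, hu, hmax⟩ := Finset.exists_max_image (Finset.range c)
    (fun u => ∑ r ∈ Finset.range s, f (u * s + r)) ⟨0, Finset.mem_range.2 hc⟩
  refine ⟨u, Finset.mem_range.1 hu, ?_⟩
  rw [sum_range_mul_eq]
  simpa using Finset.sum_le_card_nsmul _ _ _ hmax

theorem blockSize_pos {B : ℕ} (hB : 1 ≤ B) (m j : ℕ) : 0 < blockSize B m j :=
  Nat.pow_pos (by omega)

theorem blockSize_eq_mul {B m j : ℕ} (hj : j < m) :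
    blockSize B m j = 2 * B * blockSize B m (j + 1) := by
  unfold blockSize
  rw [← pow_succ', show m - (j + 1) + 1 = m - j by omega]

/-- Buffers sharing their level-`k` block share all coarser blocks. -/
theorem div_blockSize_congr {B m k x y j : ℕ} (hk : k ≤ m) (hj : j ≤ k)
    (h : x / blockSize B m k = y / blockSize B m k) :
    x / blockSize B m j = y / blockSize B m j := by
  have hs : blockSize B m j = blockSize B m k * (2 * B) ^ (k - j) := by
    unfold blockSize
    rw [← pow_add, show m - k + (k - j) = m - j by omega]
  rw [hs, ← Nat.div_div_eq_div_mul, ← Nat.div_div_eq_div_mul, h]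

/-- Every block contains a child block whose average of `f` is at least that of the block. -/
theorem exists_child_block {B m k : ℕ} (hB : 1 ≤ B) (hk : k < m) (i : ℕ) (f : ℕ → ℕ) :
    ∃ i', 1 ≤ i' ∧ (i' - 1) / blockSize B m k = (i - 1) / blockSize B m k ∧
      ((∑ x ∈ blockOf B m k i, f x : ℕ) : ℝ) / blockSize B m k
        ≤ ((∑ x ∈ blockOf B m (k + 1) i', f x : ℕ) : ℝ) / blockSize B m (k + 1) := by
  have hs := blockSize_pos hB m (k + 1)
  have hS := blockSize_pos hB m k
  have hmul := blockSize_eq_mul (B := B) hk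
  set s := blockSize B m (k + 1) with hsdef
  set S := blockSize B m k with hSdef
  set q := (i - 1) / S with hq
  obtain ⟨u, hu, hle⟩ :=
    exists_sum_range_mul_le (fun r => f (q * S + 1 + r)) (c := 2 * B) (by omega) s
  have hus : u * s < S := by rw [hmul]; exact Nat.mul_lt_mul_of_pos_right hu hs
  have hlo : blockLo B m (k + 1) (q * S + u * s + 1) = q * S + u * s + 1 := by
    unfold blockLo
    rw [← hsdef, Nat.add_sub_cancel, Nat.div_mul_cancel]
    exact dvd_add (Dvd.dvd.mul_left (Dvd.intro_left _ hmul.symm) q) (Dvd.intro_left _ rfl)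
  refine ⟨q * S + u * s + 1, by omega, ?_, ?_⟩
  · rw [Nat.add_sub_cancel, mul_comm q S, Nat.mul_add_div hS, Nat.div_eq_of_lt hus, add_zero]
  · have h1 : ∑ x ∈ blockOf B m k i, f x
        = ∑ r ∈ Finset.range (2 * B * s), f (q * S + 1 + r) := by
      rw [← hmul, ← sum_Icc_eq_sum_range]
      rfl
    have h2 : ∑ x ∈ blockOf B m (k + 1) (q * S + u * s + 1), f x
        = ∑ r ∈ Finset.range s, f (q * S + 1 + (u * s + r)) := by
      unfold blockOf
      rw [hlo, ← hsdef, sum_Icc_eq_sum_range]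
      exact Finset.sum_congr rfl fun r _ => congrArg f (by ring)
    rw [h1, h2, div_le_div_iff₀ (by exact_mod_cast hS) (by exact_mod_cast hs)]
    norm_cast
    calc _ ≤ _ := Nat.mul_le_mul_right s hle
      _ = _ := by rw [hmul]; ring

theorem exists_good_phases {B m n : ℕ} (hB : 1 ≤ B) (hn : n = (2 * B) ^ m)
    {Fp : ℕ → (ℕ → ℕ → ℕ) → ℕ → ℕ} (L0 : ℕ → ℕ)
    (honline : ∀ t : ℕ, ∀ a a' : ℕ → ℕ → ℕ, (∀ s ≤ t, a s = a' s) → Fp t a = Fp t a')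
    {k : ℕ} (hk : k ≤ m) :
    ∃ i ∈ Finset.Icc 1 n, ∀ j ∈ Finset.Icc 1 k, GoodPhase n B m Fp L0 i j := by
  induction k with
  | zero =>
    refine ⟨1, Finset.mem_Icc.2 ⟨le_rfl, ?_⟩, by simp⟩
    rw [hn]
    exact blockSize_pos hB m 0
  | succ k ih =>
    obtain ⟨i, hi, hgood⟩ := ih (by omega)
    obtain ⟨i', hi', hdiv, hle⟩ := exists_child_block hB (Nat.lt_of_succ_le hk) i
      (preLoad n Fp L0 (epInj B m i) (phaseStart B m (k + 1)))
    have hdiv' : ∀ j ≤ k, (i' - 1) / blockSize B m j = (i - 1) / blockSize B m j :=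
      fun j hj => div_blockSize_congr (by omega) hj hdiv
    have hblock : ∀ j ≤ k, blockOf B m j i' = blockOf B m j i :=
      fun j hj => blockOf_congr (hdiv' j hj)
    have hn0 : blockSize B m 0 = n := hn.symm
    rw [Finset.mem_Icc] at hi
    refine ⟨i', Finset.mem_Icc.2 ⟨hi', ?_⟩, fun j hj => ?_⟩
    · have h0 := hdiv' 0 (Nat.zero_le k)
      rw [hn0, Nat.div_eq_of_lt (show i - 1 < n by omega), Nat.div_eq_zero_iff] at h0
      omega
    · rw [Finset.mem_Icc] at hj
      unfold GoodPhase
      rw [preLoad_epInj_congr honline hblock hj.2, hblock (j - 1) (by omega)]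
      rcases Nat.lt_or_ge k j with hjk | hjk
      · obtain rfl : j = k + 1 := by omega
        exact hle
      · rw [hblock j hjk]
        exact hgood j (Finset.mem_Icc.2 ⟨hj.1, hjk⟩)

open scoped Classical in
/-- for any deterministic online forwarding protocol `Fp` and any
initial load configuration `L0` on the unit-capacity single-destination path of size
`n = (2B)^m`, if `i` is drawn uniformly from `{1, …, n}` and one epoch is run against
`Fp`, the probability that the epoch is good is at least `1/n`. -/
theorem stmt19 (B m n : ℕ) (hB : 1 ≤ B) (hm : 1 ≤ m) (hn : n = (2 * B) ^ m)
    (Fp : ℕ → (ℕ → ℕ → ℕ) → ℕ → ℕ) (L0 : ℕ → ℕ)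
    (honline : ∀ t : ℕ, ∀ a a' : ℕ → ℕ → ℕ, (∀ s ≤ t, a s = a' s) → Fp t a = Fp t a')
    (hbin : ∀ t : ℕ, ∀ a : ℕ → ℕ → ℕ, ∀ i, Fp t a i ≤ 1)
    (hempty : ∀ a : ℕ → ℕ → ℕ, ∀ t i, protLW n Fp L0 a t i = 0 → Fp t a i = 0)
    (hrange : ∀ t : ℕ, ∀ a : ℕ → ℕ → ℕ, ∀ i, ¬(1 ≤ i ∧ i ≤ n) → Fp t a i = 0) :
    (1 : ℝ) / n ≤
      (((Finset.Icc 1 n).filter (fun i => GoodEpoch n B m Fp L0 i)).card : ℝ) / n := by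
  obtain ⟨i, hi, hgood⟩ := exists_good_phases hB hn L0 honline le_rfl
  gcongr
  exact_mod_cast Finset.card_pos.2 ⟨i, Finset.mem_filter.2 ⟨hi, hgood⟩⟩
end
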